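/- For every f ∈ 𝒮(ℝ;ℂ): (i) L_Q( i·L_Q*(f) ) = i·( −∂ₓₓf + ¼·Q⁴·f − Q·|D|(Q·f) ) = i·H_Q f pointwise on ℝ; (ii) −𝐃̃_Q( 𝐃̃_Q f ) = H_Q f pointwise on ℝ, where 𝐃̃_Q f := ∂ₓf + ½·Q·H(Q·f). In particular L_Q i L_Q* = i·𝐃̃_Q*𝐃̃_Q = i·H_Q, where the formal adjoint of 𝐃̃_Q with respect to (·,·)_r is 𝐃̃_Q* = −𝐃̃_Q. -/

import Mathlib

open MeasureTheory Filter Topology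

/-- The Hilbert transform, realized as a principal-value integral:
`Hf(x) = (1/π) p.v. ∫ f(y)/(x-y) dy`. -/
noncomputable def pvH (f : ℝ → ℂ) (x : ℝ) : ℂ :=
  limUnder (nhdsWithin (0 : ℝ) (Set.Ioi 0)) fun ε : ℝ =>
    (Real.pi : ℂ)⁻¹ * ∫ y in {y : ℝ | ε < |x - y|}, f y / ((x - y : ℝ) : ℂ)

/-- The soliton `Q(x) = √2/√(1+x²)` (real-valued). -/
noncomputable def Qr (x : ℝ) : ℝ := Real.sqrt 2 / Real.sqrt (1 + x ^ 2)

/-- The soliton, viewed as a complex-valued function. -/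
noncomputable def Qc (x : ℝ) : ℂ := (Qr x : ℂ)

/-- `L_Q f = ∂ₓf + ½ H(Q²) f + Q · H(Re(Q f))`. -/
noncomputable def LQ (f : ℝ → ℂ) : ℝ → ℂ := fun x =>
  deriv f x + (1 / 2) * pvH (fun y => Qc y ^ 2) x * f x
    + Qc x * pvH (fun y => (((Qc y * f y).re : ℝ) : ℂ)) x

/-- `L_Q* f = −∂ₓf + ½ H(Q²) f − Q · H(Re(Q f))`. -/
noncomputable def LQs (f : ℝ → ℂ) : ℝ → ℂ := fun x =>
  -deriv f x + (1 / 2) * pvH (fun y => Qc y ^ 2) x * f x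
    - Qc x * pvH (fun y => (((Qc y * f y).re : ℝ) : ℂ)) x

/-- `H_Q f = −∂ₓₓ f + ¼ Q⁴ f − Q·|D|(Q f)`, with `|D|h = H(∂ₓh)`. -/
noncomputable def HQ (f : ℝ → ℂ) : ℝ → ℂ := fun x =>
  -deriv (deriv f) x + (1 / 4) * Qc x ^ 4 * f x
    - Qc x * pvH (deriv fun y => Qc y * f y) x

/-- `𝐃̃_Q f = ∂ₓ f + ½ Q · H(Q f)`. -/
noncomputable def DtQ (f : ℝ → ℂ) : ℝ → ℂ := fun x =>
  deriv f x + (1 / 2) * Qc x * pvH (fun y => Qc y * f y) x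


open scoped FourierTransform

/-- The truncated integrals defining the Hilbert transform of `f` at `x` converge to `v`. -/
def HasPV (f : ℝ → ℂ) (x : ℝ) (v : ℂ) : Prop :=
  (∀ ε : ℝ, 0 < ε → IntegrableOn (fun y => f y / ((x - y : ℝ) : ℂ)) {y : ℝ | ε < |x - y|}) ∧
  Tendsto (fun ε : ℝ => (Real.pi : ℂ)⁻¹ * ∫ y in {y : ℝ | ε < |x - y|}, f y / ((x - y : ℝ) : ℂ))
    (𝓝[>] 0) (𝓝 v)

lemma measurableSet_farFrom (x ε : ℝ) : MeasurableSet {y : ℝ | ε < |x - y|} :=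
  measurableSet_lt measurable_const (by fun_prop)

namespace HasPV

variable {f g : ℝ → ℂ} {x : ℝ} {v w : ℂ}

lemma pvH_eq (h : HasPV f x v) : pvH f x = v := h.2.limUnder_eq

lemma unique (h : HasPV f x v) (h' : HasPV f x w) : v = w := tendsto_nhds_unique h.2 h'.2

lemma add (hf : HasPV f x v) (hg : HasPV g x w) : HasPV (fun y => f y + g y) x (v + w) := by
  refine ⟨fun ε hε => ?_, ?_⟩
  · simpa only [add_div] using! (hf.1 ε hε).add (hg.1 ε hε)
  · refine (hf.2.add hg.2).congr' ?_
    filter_upwards [self_mem_nhdsWithin] with ε hε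
    rw [← mul_add, ← integral_add (hf.1 ε hε) (hg.1 ε hε)]
    simp only [add_div]

lemma const_mul (c : ℂ) (hf : HasPV f x v) : HasPV (fun y => c * f y) x (c * v) := by
  refine ⟨fun ε hε => ?_, ?_⟩
  · simpa only [mul_div_assoc] using! (hf.1 ε hε).const_mul c
  · refine (hf.2.const_mul c).congr fun ε => ?_
    simp only [mul_div_assoc, integral_const_mul]
    ring

lemma neg (hf : HasPV f x v) : HasPV (fun y => -f y) x (-v) := by
  simpa using hf.const_mul (-1)

lemma sub (hf : HasPV f x v) (hg : HasPV g x w) : HasPV (fun y => f y - g y) x (v - w) := by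
  simpa only [sub_eq_add_neg] using hf.add hg.neg

lemma conj (hf : HasPV f x v) :
    HasPV (fun y => starRingEnd ℂ (f y)) x (starRingEnd ℂ v) := by
  refine ⟨fun ε hε => ?_, ?_⟩
  · have := (hf.1 ε hε)
    refine (Complex.conjLIE.toContinuousLinearEquiv.toContinuousLinearMap.integrable_comp
      this).congr ?_
    filter_upwards with y
    simp
  · refine ((Complex.continuous_conj.tendsto v).comp hf.2).congr fun ε => ?_
    simp only [Function.comp_apply, map_mul, map_inv₀, Complex.conj_ofReal]
    rw [← integral_conj]
    simp

lemma im_eq_zero {a : ℝ → ℝ} (h : HasPV (fun y => (a y : ℂ)) x v) : v.im = 0 := by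
  have := h.unique (by simpa only [Complex.conj_ofReal] using h.conj)
  exact Complex.conj_eq_iff_im.1 this.symm

end HasPV

lemma tendsto_setIntegral_farFrom {h : ℝ → ℂ} (hh : Integrable h) (x : ℝ) :
    Tendsto (fun ε : ℝ => ∫ y in {y : ℝ | ε < |x - y|}, h y) (𝓝[>] 0) (𝓝 (∫ y, h y)) := by
  simp_rw [← integral_indicator (measurableSet_farFrom x _)]
  refine tendsto_integral_filter_of_dominated_convergence (fun y => ‖h y‖) ?_ ?_ hh.norm ?_
  · exact Eventually.of_forall fun ε => hh.1.indicator (measurableSet_farFrom x ε)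
  · exact Eventually.of_forall fun ε => Eventually.of_forall fun y => norm_indicator_le_norm_self _ _
  · have : ∀ᵐ y : ℝ, y ≠ x := by simp [ae_iff]
    filter_upwards [this] with y hy
    refine tendsto_const_nhds.congr' ?_
    have : 0 < |x - y| := abs_pos.2 (sub_ne_zero.2 hy.symm)
    filter_upwards [Ioo_mem_nhdsGT this] with ε hε
    rw [Set.indicator_of_mem]
    exact hε.2

/-- Adding `k y * (x - y)` to `f` for integrable `k` shifts the principal value by `π⁻¹ ∫ k`. -/
lemma HasPV.of_eq_add {f g k : ℝ → ℂ} {x : ℝ} {v : ℂ} (hf : HasPV f x v) (hk : Integrable k)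
    (h : ∀ y, g y = f y + k y * ((x - y : ℝ) : ℂ)) :
    HasPV g x (v + (Real.pi : ℂ)⁻¹ * ∫ y, k y) := by
  have key : ∀ ε : ℝ, 0 < ε → ∀ y ∈ {y : ℝ | ε < |x - y|},
      f y / ((x - y : ℝ) : ℂ) + k y = g y / ((x - y : ℝ) : ℂ) := by
    intro ε hε y hy
    have : ((x - y : ℝ) : ℂ) ≠ 0 := by
      have : 0 < |x - y| := hε.trans hy
      exact_mod_cast abs_pos.1 this
    rw [h]
    field_simp
  refine ⟨fun ε hε => ?_, ?_⟩
  · exact (integrableOn_congr_fun (key ε hε) (measurableSet_farFrom x ε)).1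
      ((hf.1 ε hε).add hk.integrableOn)
  · refine (hf.2.add ((tendsto_setIntegral_farFrom hk x).const_mul _)).congr' ?_
    filter_upwards [self_mem_nhdsWithin] with ε hε
    rw [← mul_add, ← integral_add (hf.1 ε hε) hk.integrableOn]
    rw [setIntegral_congr_fun (measurableSet_farFrom x ε) (key ε hε)]

/-- A continuous function of size `O(1 / (1 + |y|))`. -/
def Decays (f : ℝ → ℂ) : Prop :=
  Continuous f ∧ ∃ C, ∀ y, ‖f y‖ * (1 + |y|) ≤ C

lemma inv_mul_inv_le_of_far {x y ε : ℝ} (hε : 0 < ε) (h : ε < |x - y|) :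
    (1 + |y|)⁻¹ * |x - y|⁻¹ ≤ ((1 + |x|) * (1 + ε⁻¹)) * (1 + (x - y) ^ 2)⁻¹ := by
  have h0 : 0 < |x - y| := hε.trans h
  have h1 : |x - y| ≤ |x| + |y| := abs_sub x y
  have h2 : 1 + |x - y| ≤ (1 + |x|) * (1 + |y|) := by
    nlinarith [abs_nonneg x, abs_nonneg y]
  have h3 : 1 + |x - y| ≤ (1 + ε⁻¹) * |x - y| := by
    have : ε⁻¹ * |x - y| ≥ 1 := by
      rw [ge_iff_le, inv_mul_eq_div, one_le_div hε]; exact h.le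
    linarith
  have h4 : 1 + (x - y) ^ 2 ≤ (1 + |x - y|) * (1 + |x - y|) := by
    rw [← sq_abs]; nlinarith
  have h5 := mul_le_mul h2 h3 (by positivity) (by positivity)
  rw [← mul_inv, ← div_eq_mul_inv, le_div_iff₀ (by positivity), inv_mul_le_iff₀ (by positivity)]
  linarith

lemma integrable_inv_one_add_sub_sq (x : ℝ) : Integrable fun y : ℝ => (1 + (x - y) ^ 2)⁻¹ :=
  integrable_inv_one_add_sq.comp_sub_left x

namespace Decays

variable {f : ℝ → ℂ}

lemma integrableOn_div (hf : Decays f) (x : ℝ) {ε : ℝ} (hε : 0 < ε) :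
    IntegrableOn (fun y => f y / ((x - y : ℝ) : ℂ)) {y : ℝ | ε < |x - y|} := by
  obtain ⟨hc, C, hC⟩ := hf
  refine Integrable.mono'
    ((integrable_inv_one_add_sub_sq x).const_mul (C * ((1 + |x|) * (1 + ε⁻¹)))).integrableOn ?_ ?_
  · exact (hc.measurable.div (by fun_prop)).aestronglyMeasurable
  · refine (ae_restrict_iff' (measurableSet_farFrom x ε)).2 (Eventually.of_forall fun y hy => ?_)
    have hC0 : 0 ≤ C := le_trans (by positivity) (hC y)
    have h1 : ‖f y‖ ≤ C * (1 + |y|)⁻¹ := by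
      rw [← div_eq_mul_inv, le_div_iff₀ (by positivity)]; exact hC y
    rw [norm_div, Complex.norm_real, Real.norm_eq_abs, div_eq_mul_inv]
    calc ‖f y‖ * |x - y|⁻¹ ≤ (C * (1 + |y|)⁻¹) * |x - y|⁻¹ := by gcongr
      _ = C * ((1 + |y|)⁻¹ * |x - y|⁻¹) := by ring
      _ ≤ _ := by
        rw [mul_assoc]
        exact mul_le_mul_of_nonneg_left (inv_mul_inv_le_of_far hε hy) hC0

lemma integrable_mul_inv (hf : Decays f) :
    Integrable fun y => ((1 + y ^ 2 : ℝ) : ℂ)⁻¹ * f y := by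
  obtain ⟨hc, C, hC⟩ := hf
  refine Integrable.mono' (integrable_inv_one_add_sq.const_mul C) ?_ ?_
  · exact (Measurable.mul (by fun_prop) hc.measurable).aestronglyMeasurable
  · refine Eventually.of_forall fun y => ?_
    rw [norm_mul, norm_inv, Complex.norm_real, Real.norm_of_nonneg (by positivity), mul_comm]
    gcongr
    refine le_trans ?_ (hC y)
    nlinarith [norm_nonneg (f y), abs_nonneg y]

lemma integrable_mul_mul_inv (hf : Decays f) :
    Integrable fun y : ℝ => (y : ℂ) * (((1 + y ^ 2 : ℝ) : ℂ)⁻¹ * f y) := by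
  obtain ⟨hc, C, hC⟩ := hf
  refine Integrable.mono' (integrable_inv_one_add_sq.const_mul C) ?_ ?_
  · refine (Measurable.mul (by fun_prop) (Measurable.mul (by fun_prop) ?_)).aestronglyMeasurable
    exact hc.measurable
  · refine Eventually.of_forall fun y => ?_
    rw [mul_left_comm, norm_mul, norm_inv, Complex.norm_real, Real.norm_of_nonneg (by positivity),
      mul_comm]
    gcongr
    refine le_trans ?_ (hC y)
    rw [norm_mul, Complex.norm_real, Real.norm_eq_abs]
    nlinarith [norm_nonneg (f y), abs_nonneg y]

end Decays

/-- Partial fractions: the principal value of `f / (1 + y²)`. -/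
lemma HasPV.inv_mul {f : ℝ → ℂ} {x : ℝ} {v : ℂ} (h : HasPV f x v) (hf : Decays f) :
    HasPV (fun y => ((1 + y ^ 2 : ℝ) : ℂ)⁻¹ * f y) x (((1 + x ^ 2 : ℝ) : ℂ)⁻¹ *
      (v + (Real.pi : ℂ)⁻¹ * (x * (∫ y : ℝ, ((1 + y ^ 2 : ℝ) : ℂ)⁻¹ * f y) +
        ∫ y : ℝ, (y : ℂ) * (((1 + y ^ 2 : ℝ) : ℂ)⁻¹ * f y)))) := by
  have hk := ((hf.integrable_mul_inv.const_mul (x : ℂ)).add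
    hf.integrable_mul_mul_inv).const_mul (((1 + x ^ 2 : ℝ) : ℂ)⁻¹)
  convert! (h.const_mul (((1 + x ^ 2 : ℝ) : ℂ)⁻¹)).of_eq_add hk fun y => ?_ using 1
  · simp only [Pi.add_apply]
    rw [integral_const_mul, integral_add (hf.integrable_mul_inv.const_mul (x : ℂ))
      hf.integrable_mul_mul_inv, integral_const_mul]
    ring
  · have hx : ((1 + x ^ 2 : ℝ) : ℂ) ≠ 0 := by exact_mod_cast (by positivity : (1 + x ^ 2 : ℝ) ≠ 0)
    have hy : ((1 + y ^ 2 : ℝ) : ℂ) ≠ 0 := by exact_mod_cast (by positivity : (1 + y ^ 2 : ℝ) ≠ 0)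
    simp only [Pi.add_apply]
    field_simp
    push_cast
    ring

/-- Partial fractions: the principal value of `y f / (1 + y²)`. -/
lemma HasPV.mul_inv_mul {f : ℝ → ℂ} {x : ℝ} {v : ℂ} (h : HasPV f x v) (hf : Decays f) :
    HasPV (fun y => (y : ℂ) * (((1 + y ^ 2 : ℝ) : ℂ)⁻¹ * f y)) x (((1 + x ^ 2 : ℝ) : ℂ)⁻¹ *
      (x * v - (Real.pi : ℂ)⁻¹ * ((∫ y : ℝ, ((1 + y ^ 2 : ℝ) : ℂ)⁻¹ * f y) -
        x * ∫ y : ℝ, (y : ℂ) * (((1 + y ^ 2 : ℝ) : ℂ)⁻¹ * f y)))) := by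
  have hk := ((hf.integrable_mul_mul_inv.const_mul (x : ℂ)).sub
    hf.integrable_mul_inv).const_mul (((1 + x ^ 2 : ℝ) : ℂ)⁻¹)
  convert! (h.const_mul (((1 + x ^ 2 : ℝ) : ℂ)⁻¹ * x)).of_eq_add hk fun y => ?_ using 1
  · simp only [Pi.sub_apply]
    rw [integral_const_mul, integral_sub (hf.integrable_mul_mul_inv.const_mul (x : ℂ))
      hf.integrable_mul_inv, integral_const_mul]
    ring
  · have hx : ((1 + x ^ 2 : ℝ) : ℂ) ≠ 0 := by exact_mod_cast (by positivity : (1 + x ^ 2 : ℝ) ≠ 0)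
    have hy : ((1 + y ^ 2 : ℝ) : ℂ) ≠ 0 := by exact_mod_cast (by positivity : (1 + y ^ 2 : ℝ) ≠ 0)
    simp only [Pi.sub_apply]
    field_simp
    push_cast
    ring

lemma exists_tendsto_integral_sinc :
    ∃ L : ℝ, Tendsto (fun z : ℝ => ∫ t in (0 : ℝ)..z, Real.sinc t) atTop (𝓝 L) := by
  have hint : IntegrableOn (fun t : ℝ => Real.cos t / t ^ 2) (Set.Ioi 1) := by
    refine Integrable.mono' (integrableOn_Ioi_rpow_of_lt (a := -2) (by norm_num) one_pos) ?_ ?_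
    · exact (Measurable.div (by fun_prop) (by fun_prop)).aestronglyMeasurable
    · refine (ae_restrict_iff' measurableSet_Ioi).2 (Eventually.of_forall fun t ht => ?_)
      have ht0 : (0 : ℝ) < t := one_pos.trans ht
      rw [norm_div, Real.norm_eq_abs, Real.norm_of_nonneg (by positivity), Real.rpow_neg ht0.le,
        div_eq_mul_inv]
      norm_cast
      exact mul_le_of_le_one_left (by positivity) (Real.abs_cos_le_one t)
  have h1 : Tendsto (fun z : ℝ => ∫ t in (1 : ℝ)..z, Real.cos t / t ^ 2) atTop _ :=
    intervalIntegral_tendsto_integral_Ioi 1 hint tendsto_id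
  have h2 : Tendsto (fun z : ℝ => -(Real.cos z * z⁻¹)) atTop (𝓝 (-0)) := by
    refine Tendsto.neg ?_
    refine bdd_le_mul_tendsto_zero' 1 (Eventually.of_forall fun z => ?_) tendsto_inv_atTop_zero
    exact Real.abs_cos_le_one z
  refine ⟨_, (((h2.add_const (Real.cos 1)).sub h1).const_add
    (∫ t in (0 : ℝ)..1, Real.sinc t)).congr' ?_⟩
  filter_upwards [eventually_ge_atTop (1 : ℝ)] with z hz
  have hii : ∀ a b : ℝ, IntervalIntegrable Real.sinc volume a b :=
    fun a b => Real.continuous_sinc.intervalIntegrable a b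
  rw [← intervalIntegral.integral_add_adjacent_intervals (hii 0 1) (hii 1 z)]
  have hcos : IntervalIntegrable (fun t : ℝ => Real.cos t / t ^ 2) volume 1 z :=
    (intervalIntegrable_iff_integrableOn_Ioc_of_le hz).2 (hint.mono_set Set.Ioc_subset_Ioi_self)
  have := intervalIntegral.integral_eq_sub_of_hasDerivAt (a := 1) (b := z)
    (f := fun t => -(Real.cos t * t⁻¹)) (f' := fun t => Real.sinc t + Real.cos t / t ^ 2)
    (fun t ht => by
      rw [Set.uIcc_of_le hz] at ht
      have ht0 : t ≠ 0 := (one_pos.trans_le ht.1).ne'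
      convert! ((Real.hasDerivAt_cos t).mul (hasDerivAt_inv ht0)).neg using 1
      rw [Real.sinc_of_ne_zero ht0]
      field_simp
      ring) ((hii 1 z).add hcos)
  rw [intervalIntegral.integral_add (hii 1 z) hcos] at this
  simp only [inv_one, mul_one, sub_neg_eq_add] at this
  linarith

/-- The sine integral. -/
noncomputable def sineIntegral (z : ℝ) : ℝ := ∫ t in (0 : ℝ)..z, Real.sinc t

lemma sineIntegral_zero : sineIntegral 0 = 0 := by simp [sineIntegral]

lemma sineIntegral_neg (z : ℝ) : sineIntegral (-z) = -sineIntegral z := by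
  have := intervalIntegral.integral_comp_neg (a := 0) (b := z) Real.sinc
  simp only [Real.sinc_neg, neg_zero] at this
  rw [sineIntegral, sineIntegral, this, intervalIntegral.integral_symm]

lemma continuous_sineIntegral : Continuous sineIntegral :=
  intervalIntegral.continuous_primitive (fun a b => Real.continuous_sinc.intervalIntegrable a b) 0

/-- The limit of the sine integral at infinity. -/
noncomputable def sineIntegralTop : ℝ := exists_tendsto_integral_sinc.choose

lemma tendsto_sineIntegral : Tendsto sineIntegral atTop (𝓝 sineIntegralTop) :=
  exists_tendsto_integral_sinc.choose_spec

lemma exists_abs_sineIntegral_le : ∃ C, ∀ z, |sineIntegral z| ≤ C := by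
  obtain ⟨N, hN⟩ := eventually_atTop.1
    (tendsto_sineIntegral.abs.eventually (gt_mem_nhds (lt_add_one |sineIntegralTop|)))
  obtain ⟨C, hC⟩ := (isCompact_Icc (a := (0 : ℝ)) (b := N)).exists_bound_of_continuousOn
    continuous_sineIntegral.continuousOn
  have hpos : ∀ z, 0 ≤ z → |sineIntegral z| ≤ max C (|sineIntegralTop| + 1) := by
    intro z hz
    rcases le_total z N with h | h
    · exact (hC z ⟨hz, h⟩).trans (le_max_left _ _)
    · exact (hN z h).le.trans (le_max_right _ _)
  refine ⟨max C (|sineIntegralTop| + 1), fun z => ?_⟩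
  rcases le_total 0 z with h | h
  · exact hpos z h
  · simpa [sineIntegral_neg] using hpos (-z) (by linarith)

lemma tendsto_sineIntegral_mul (ξ : ℝ) :
    Tendsto (fun R : ℝ => sineIntegral (2 * Real.pi * ξ * R)) atTop
      (𝓝 (sineIntegralTop * Real.sign ξ)) := by
  rcases lt_trichotomy ξ 0 with h | h | h
  · have : Tendsto (fun R : ℝ => 2 * Real.pi * (-ξ) * R) atTop atTop :=
      tendsto_id.const_mul_atTop (by have := Real.pi_pos; have : 0 < -ξ := by linarith
                                     positivity)
    rw [Real.sign_of_neg h, mul_neg_one]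
    refine (tendsto_sineIntegral.comp this).neg.congr fun R => ?_
    rw [Function.comp_apply, ← sineIntegral_neg]
    ring_nf
  · simp [h, sineIntegral_zero]
  · rw [Real.sign_of_pos h, mul_one]
    exact tendsto_sineIntegral.comp (tendsto_id.const_mul_atTop (by positivity))

/-- The kernel `1 / t` truncated to `ε < |t| ≤ R`. -/
noncomputable def truncKer (ε R : ℝ) (t : ℝ) : ℂ :=
  Set.indicator {t : ℝ | ε < |t| ∧ |t| ≤ R} (fun t => ((t : ℝ) : ℂ)⁻¹) t

lemma measurableSet_annulus (ε R : ℝ) : MeasurableSet {t : ℝ | ε < |t| ∧ |t| ≤ R} := by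
  have h1 : MeasurableSet {t : ℝ | ε < |t|} := measurableSet_lt measurable_const (by fun_prop)
  have h2 : MeasurableSet {t : ℝ | |t| ≤ R} := measurableSet_le (by fun_prop) measurable_const
  exact h1.inter h2

lemma integrable_truncKer {ε : ℝ} (hε : 0 < ε) (R : ℝ) : Integrable (truncKer ε R) := by
  refine (integrable_indicator_iff (measurableSet_annulus ε R)).2 ?_
  refine Measure.integrableOn_of_bounded (M := ε⁻¹) ?_ ?_ ?_
  · refine ne_top_of_le_ne_top (measure_Icc_lt_top (a := -R) (b := R)).ne (measure_mono ?_)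
    exact fun t ht => abs_le.1 ht.2
  · exact (Measurable.inv (by fun_prop)).aestronglyMeasurable
  · refine (ae_restrict_iff' (measurableSet_annulus ε R)).2 (Eventually.of_forall fun t ht => ?_)
    rw [norm_inv, Complex.norm_real, Real.norm_eq_abs]
    exact inv_anti₀ hε ht.1.le

lemma integral_eq_integral_Ioi_add_neg {φ : ℝ → ℂ} (hφ : Integrable φ) :
    ∫ t, φ t = ∫ t in Set.Ioi (0 : ℝ), (φ t + φ (-t)) := by
  rw [integral_add hφ.integrableOn hφ.comp_neg.integrableOn, integral_comp_neg_Ioi, neg_zero,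
    add_comm]
  have := integral_add_compl (measurableSet_Iic (a := (0 : ℝ))) hφ
  rw [Set.compl_Iic] at this
  exact this.symm

lemma integral_truncKer_mul_exp {ε R : ℝ} (hε : 0 < ε) (hR : ε ≤ R) (ξ : ℝ) :
    ∫ t : ℝ, truncKer ε R t * Complex.exp (-(2 * Real.pi * t * ξ * Complex.I)) =
      -2 * Complex.I * ((sineIntegral (2 * Real.pi * ξ * R) -
        sineIntegral (2 * Real.pi * ξ * ε) : ℝ) : ℂ) := by
  have hint : Integrable fun t : ℝ =>
      truncKer ε R t * Complex.exp (-(2 * Real.pi * t * ξ * Complex.I)) := by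
    refine (integrable_truncKer hε R).mul_bdd (c := 1) (by fun_prop) ?_
    refine Eventually.of_forall fun t => le_of_eq ?_
    have : (-(2 * Real.pi * t * ξ * Complex.I) : ℂ) = ((-(2 * Real.pi * t * ξ) : ℝ) : ℂ) *
      Complex.I := by push_cast; ring
    rw [this, Complex.norm_exp_ofReal_mul_I]
  rw [integral_eq_integral_Ioi_add_neg hint]
  have h1 : ∀ t ∈ Set.Ioi (0 : ℝ),
      truncKer ε R t * Complex.exp (-(2 * Real.pi * t * ξ * Complex.I)) +
        truncKer ε R (-t) * Complex.exp (-(2 * Real.pi * (-t : ℝ) * ξ * Complex.I)) =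
      Set.indicator (Set.Ioc ε R) (fun t => -2 * Complex.I *
        ((2 * Real.pi * ξ * Real.sinc (2 * Real.pi * ξ * t) : ℝ) : ℂ)) t := by
    intro t ht
    have ht0 : 0 < t := ht
    by_cases hmem : t ∈ Set.Ioc ε R
    · have e1 : truncKer ε R t = (t : ℂ)⁻¹ :=
        Set.indicator_of_mem (by simpa [abs_of_pos ht0] using! hmem) _
      have e2 : truncKer ε R (-t) = ((-t : ℝ) : ℂ)⁻¹ :=
        Set.indicator_of_mem (by simpa [abs_of_pos ht0] using! hmem) _
      rw [Set.indicator_of_mem hmem, e1, e2]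
      rcases eq_or_ne ξ 0 with rfl | hξ
      · simp [inv_neg]
      · have hz : 2 * Real.pi * ξ * t ≠ 0 := by have := Real.pi_ne_zero; positivity
        rw [Real.sinc_of_ne_zero hz]
        have hs : 2 * Real.pi * ξ * (Real.sin (2 * Real.pi * ξ * t) / (2 * Real.pi * ξ * t)) =
            Real.sin (2 * Real.pi * ξ * t) / t := by
          have := Real.pi_ne_zero
          field_simp
        rw [hs]
        push_cast
        rw [Complex.sin]
        have a1 : (-(2 * Real.pi * t * ξ * Complex.I) : ℂ) =
          -(2 * Real.pi * ξ * t) * Complex.I := by ring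
        have a2 : (-(2 * Real.pi * -t * ξ * Complex.I) : ℂ) =
          (2 * Real.pi * ξ * t) * Complex.I := by ring
        rw [a1, a2]
        field_simp
        ring_nf
        rw [Complex.I_sq]
        ring
    · have e1 : truncKer ε R t = 0 :=
        Set.indicator_of_notMem (by simpa [abs_of_pos ht0] using! hmem) _
      have e2 : truncKer ε R (-t) = 0 :=
        Set.indicator_of_notMem (by simpa [abs_of_pos ht0] using! hmem) _
      rw [Set.indicator_of_notMem hmem, e1, e2]
      simp
  rw [setIntegral_congr_fun measurableSet_Ioi h1, setIntegral_indicator measurableSet_Ioc,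
    Set.inter_eq_self_of_subset_right (Set.Ioc_subset_Ioi_self.trans (Set.Ioi_subset_Ioi hε.le)),
    integral_const_mul,
    integral_complex_ofReal, ← intervalIntegral.integral_of_le hR, intervalIntegral.integral_const_mul,
    intervalIntegral.mul_integral_comp_mul_left]
  congr 2
  rw [sineIntegral, sineIntegral, intervalIntegral.integral_interval_sub_left]
  all_goals exact Real.continuous_sinc.intervalIntegrable _ _

lemma integral_fourierInv_mul_eq {f g : ℝ → ℂ} (hf : Integrable f) (hg : Integrable g) :
    ∫ ξ, 𝓕⁻ f ξ * g ξ = ∫ y, f y * 𝓕⁻ g y := by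
  have := VectorFourier.integral_fourierIntegral_smul_eq_flip (L := -innerₗ ℝ) (μ := volume)
    (ν := volume) Real.continuous_fourierChar
    (show Continuous fun p : ℝ × ℝ => (-innerₗ ℝ) p.1 p.2 from by
      simpa using! (continuous_snd.mul continuous_fst).neg) hf hg
  rw [show (-innerₗ ℝ : ℝ →ₗ[ℝ] ℝ →ₗ[ℝ] ℝ).flip = -innerₗ ℝ by ext; simp] at this
  exact this

lemma fourierInv_real_eq (G : ℝ → ℂ) (x : ℝ) :
    𝓕⁻ G x = ∫ ξ : ℝ, Complex.exp (2 * Real.pi * x * ξ * Complex.I) * G ξ := by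
  rw [Real.fourierInv_eq']
  refine integral_congr_ae (Eventually.of_forall fun ξ => ?_)
  simp only [smul_eq_mul, RCLike.inner_apply, conj_trivial]
  push_cast
  ring_nf

lemma norm_exp_two_pi (x ξ : ℝ) : ‖Complex.exp (2 * Real.pi * x * ξ * Complex.I)‖ = 1 := by
  have : (2 * Real.pi * x * ξ * Complex.I : ℂ) = ((2 * Real.pi * x * ξ : ℝ) : ℂ) *
    Complex.I := by push_cast; ring
  rw [this, Complex.norm_exp_ofReal_mul_I]

lemma fourierInv_truncKer {ε R : ℝ} (hε : 0 < ε) (hR : ε ≤ R) (x ξ : ℝ) :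
    𝓕⁻ (fun y => truncKer ε R (x - y)) ξ = Complex.exp (2 * Real.pi * x * ξ * Complex.I) *
      (-2 * Complex.I * ((sineIntegral (2 * Real.pi * ξ * R) -
        sineIntegral (2 * Real.pi * ξ * ε) : ℝ) : ℂ)) := by
  rw [fourierInv_real_eq, ← integral_truncKer_mul_exp hε hR, ← integral_const_mul,
    ← integral_sub_left_eq_self (fun t : ℝ => Complex.exp (2 * Real.pi * x * ξ * Complex.I) *
      (truncKer ε R t * Complex.exp (-(2 * Real.pi * t * ξ * Complex.I)))) volume x]
  refine integral_congr_ae (Eventually.of_forall fun y => ?_)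
  simp only
  rw [mul_left_comm, ← Complex.exp_add, mul_comm]
  congr 2
  push_cast
  ring

/-- The Fourier multiplier `-i sgn`. -/
noncomputable def sgnMul (G : ℝ → ℂ) (ξ : ℝ) : ℂ := -Complex.I * (Real.sign ξ : ℂ) * G ξ

lemma measurable_sign : Measurable Real.sign := by
  unfold Real.sign
  exact Measurable.ite measurableSet_Iio measurable_const
    (Measurable.ite measurableSet_Ioi measurable_const measurable_const)

lemma norm_sign_le (ξ : ℝ) : ‖(Real.sign ξ : ℂ)‖ ≤ 1 := by
  rcases Real.sign_apply_eq ξ with h | h | h <;> simp [h]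

lemma integrable_sgnMul {G : ℝ → ℂ} (hG : Integrable G) : Integrable (sgnMul G) := by
  refine hG.bdd_mul (c := 1) (by have := measurable_sign; fun_prop) ?_
  refine Eventually.of_forall fun ξ => ?_
  simpa using norm_sign_le ξ

lemma setIntegral_farFrom_fourierInv {G : ℝ → ℂ} (hG : Integrable G) {x ε : ℝ} (hε : 0 < ε)
    (hoff : IntegrableOn (fun y => 𝓕⁻ G y / ((x - y : ℝ) : ℂ)) {y : ℝ | ε < |x - y|}) :
    ∫ y in {y : ℝ | ε < |x - y|}, 𝓕⁻ G y / ((x - y : ℝ) : ℂ) =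
      ∫ ξ : ℝ, Complex.exp (2 * Real.pi * x * ξ * Complex.I) * (-2 * Complex.I *
        ((sineIntegralTop * Real.sign ξ - sineIntegral (2 * Real.pi * ξ * ε) : ℝ) : ℂ)) * G ξ := by
  obtain ⟨C, hC⟩ := exists_abs_sineIntegral_le
  have h1 : Tendsto (fun R : ℝ => ∫ y, truncKer ε R (x - y) * 𝓕⁻ G y) atTop
      (𝓝 (∫ y in {y : ℝ | ε < |x - y|}, 𝓕⁻ G y / ((x - y : ℝ) : ℂ))) := by
    have hoff' := (integrable_indicator_iff (measurableSet_farFrom x ε)).2 hoff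
    have heq : ∀ R y, truncKer ε R (x - y) * 𝓕⁻ G y = Set.indicator {y | |x - y| ≤ R}
        (Set.indicator {y : ℝ | ε < |x - y|} fun y => 𝓕⁻ G y / ((x - y : ℝ) : ℂ)) y := by
      intro R y
      by_cases a : ε < |x - y| <;> by_cases b : |x - y| ≤ R <;>
        simp [truncKer, Set.indicator, a, b, div_eq_inv_mul]
    rw [← integral_indicator (measurableSet_farFrom x ε)]
    simp_rw [heq]
    refine tendsto_integral_filter_of_dominated_convergence _
      (Eventually.of_forall fun R => hoff'.1.indicator ?_)
      (Eventually.of_forall fun R => Eventually.of_forall fun y => norm_indicator_le_norm_self _ _)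
      hoff'.norm (Eventually.of_forall fun y => ?_)
    · exact measurableSet_le (by fun_prop) measurable_const
    · refine tendsto_const_nhds.congr' ?_
      filter_upwards [eventually_ge_atTop |x - y|] with R hR
      exact (Set.indicator_of_mem (s := {y | |x - y| ≤ R}) hR _).symm
  have h2 : Tendsto (fun R : ℝ => ∫ y, truncKer ε R (x - y) * 𝓕⁻ G y) atTop
      (𝓝 (∫ ξ : ℝ, Complex.exp (2 * Real.pi * x * ξ * Complex.I) * (-2 * Complex.I *
        ((sineIntegralTop * Real.sign ξ - sineIntegral (2 * Real.pi * ξ * ε) : ℝ) : ℂ)) * G ξ)) := by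
    have : (fun R : ℝ => ∫ ξ : ℝ, Complex.exp (2 * Real.pi * x * ξ * Complex.I) *
        (-2 * Complex.I * ((sineIntegral (2 * Real.pi * ξ * R) -
        sineIntegral (2 * Real.pi * ξ * ε) : ℝ) : ℂ)) * G ξ) =ᶠ[atTop]
        fun R : ℝ => ∫ y, truncKer ε R (x - y) * 𝓕⁻ G y := by
      filter_upwards [eventually_ge_atTop ε] with R hR
      rw [← integral_fourierInv_mul_eq ((integrable_truncKer hε R).comp_sub_left x) hG]
      simp_rw [fourierInv_truncKer hε hR]
    refine Tendsto.congr' this ?_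
    refine tendsto_integral_filter_of_dominated_convergence (fun ξ => 2 * (C + C) * ‖G ξ‖)
      (Eventually.of_forall fun R => ?_)
      (Eventually.of_forall fun R => Eventually.of_forall fun ξ => ?_)
      (hG.norm.const_mul _) (Eventually.of_forall fun ξ => ?_)
    · have := continuous_sineIntegral
      exact AEStronglyMeasurable.mul (Continuous.aestronglyMeasurable (by fun_prop)) hG.1
    · rw [norm_mul, norm_mul, norm_exp_two_pi, one_mul, norm_mul, Complex.norm_real]
      have := norm_sub_le_of_le (Real.norm_eq_abs _ ▸ hC (2 * Real.pi * ξ * R))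
        (Real.norm_eq_abs _ ▸ hC (2 * Real.pi * ξ * ε))
      simp only [norm_mul, norm_neg, Complex.norm_I, mul_one, Complex.norm_ofNat]
      gcongr
    · refine Tendsto.mul_const _ (Tendsto.const_mul _ (Tendsto.const_mul _ ?_))
      exact (Complex.continuous_ofReal.tendsto _).comp
        ((tendsto_sineIntegral_mul ξ).sub_const _)
  exact tendsto_nhds_unique h1 h2

/-- The principal value of an inverse Fourier transform, up to the value of the Dirichlet
integral. -/
lemma hasPV_fourierInv_aux {G : ℝ → ℂ} (hG : Integrable G) {x : ℝ}
    (hoff : ∀ ε : ℝ, 0 < ε →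
      IntegrableOn (fun y => 𝓕⁻ G y / ((x - y : ℝ) : ℂ)) {y : ℝ | ε < |x - y|}) :
    HasPV (𝓕⁻ G) x ((2 * sineIntegralTop / Real.pi : ℝ) * 𝓕⁻ (sgnMul G) x) := by
  obtain ⟨C, hC⟩ := exists_abs_sineIntegral_le
  have hval : ((2 * sineIntegralTop / Real.pi : ℝ) * 𝓕⁻ (sgnMul G) x) = (Real.pi : ℂ)⁻¹ *
      ∫ ξ : ℝ, Complex.exp (2 * Real.pi * x * ξ * Complex.I) * (-2 * Complex.I *
        ((sineIntegralTop * Real.sign ξ - 0 : ℝ) : ℂ)) * G ξ := by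
    rw [fourierInv_real_eq, ← integral_const_mul, ← integral_const_mul]
    refine integral_congr_ae (Eventually.of_forall fun ξ => ?_)
    simp only [sgnMul]
    push_cast
    ring
  refine ⟨hoff, ?_⟩
  rw [hval]
  refine Tendsto.congr' (f₁ := fun ε : ℝ => (Real.pi : ℂ)⁻¹ *
      ∫ ξ : ℝ, Complex.exp (2 * Real.pi * x * ξ * Complex.I) * (-2 * Complex.I *
        ((sineIntegralTop * Real.sign ξ - sineIntegral (2 * Real.pi * ξ * ε) : ℝ) : ℂ)) * G ξ) ?_ ?_
  · filter_upwards [self_mem_nhdsWithin] with ε hε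
    rw [setIntegral_farFrom_fourierInv hG hε (hoff ε hε)]
  · refine Tendsto.const_mul _ (tendsto_integral_filter_of_dominated_convergence
      (fun ξ => 2 * (|sineIntegralTop| + C) * ‖G ξ‖)
      (Eventually.of_forall fun R => ?_)
      (Eventually.of_forall fun R => Eventually.of_forall fun ξ => ?_)
      (hG.norm.const_mul _) (Eventually.of_forall fun ξ => ?_))
    · have := continuous_sineIntegral.measurable
      have := measurable_sign
      exact AEStronglyMeasurable.mul (Measurable.aestronglyMeasurable (by fun_prop)) hG.1
    · rw [norm_mul, norm_mul, norm_exp_two_pi, one_mul, norm_mul, Complex.norm_real]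
      have hs : ‖sineIntegralTop * Real.sign ξ‖ ≤ |sineIntegralTop| := by
        have := norm_sign_le ξ
        rw [Complex.norm_real] at this
        rw [norm_mul]
        exact mul_le_of_le_one_right (abs_nonneg _) this
      have := norm_sub_le_of_le hs (Real.norm_eq_abs _ ▸ hC (2 * Real.pi * ξ * R))
      simp only [norm_mul, norm_neg, Complex.norm_I, mul_one, Complex.norm_ofNat]
      gcongr
    · refine Tendsto.mul_const _ (Tendsto.const_mul _ (Tendsto.const_mul _ ?_))
      refine (Complex.continuous_ofReal.tendsto _).comp (Tendsto.const_sub _ ?_)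
      have : Continuous fun ε : ℝ => sineIntegral (2 * Real.pi * ξ * ε) :=
        continuous_sineIntegral.comp (by fun_prop)
      simpa [sineIntegral_zero] using (this.tendsto 0).mono_left nhdsWithin_le_nhds


/-- The profile whose inverse Fourier transform is the Poisson kernel. -/
noncomputable def expNegAbs (ξ : ℝ) : ℂ := Complex.exp (-(2 * Real.pi * |ξ| : ℝ))

lemma re_two_pi_mul_sub_one (x : ℝ) :
    ((2 * Real.pi : ℂ) * (x * Complex.I - 1)).re < 0 := by
  have : ((2 * Real.pi : ℂ) * (x * Complex.I - 1)).re = -(2 * Real.pi) := by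
    simp
  rw [this]
  have := Real.pi_pos
  linarith

lemma integrable_expNegAbs : Integrable expNegAbs := by
  have hc : Continuous expNegAbs := by unfold expNegAbs; fun_prop
  have h1 : IntegrableOn expNegAbs (Set.Ioi 0) := by
    refine (integrableOn_exp_mul_complex_Ioi (re_two_pi_mul_sub_one 0) 0).congr_fun
      (fun t ht => ?_) measurableSet_Ioi
    simp only [expNegAbs, abs_of_pos (Set.mem_Ioi.1 ht)]
    congr 1
    push_cast
    ring
  have h2 : IntegrableOn expNegAbs (Set.Iio 0) := by
    have := h1.comp_neg
    rw [Set.neg_Ioi, neg_zero] at this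
    refine this.congr_fun (fun t _ => ?_) measurableSet_Iio
    simp [expNegAbs]
  have h3 : IntegrableOn expNegAbs (Set.Iic 0) := by
    rwa [integrableOn_Iic_iff_integrableOn_Iio]
  rw [← integrableOn_univ, ← Set.Iic_union_Ioi (a := (0 : ℝ))]
  exact h3.union h1

lemma integrable_exp_mul {G : ℝ → ℂ} (hG : Integrable G) (x : ℝ) :
    Integrable fun ξ : ℝ => Complex.exp (2 * Real.pi * x * ξ * Complex.I) * G ξ :=
  hG.bdd_mul (c := 1) (by fun_prop) (Eventually.of_forall fun ξ => (norm_exp_two_pi x ξ).le)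

lemma integral_Ioi_exp_two_pi (x : ℝ) :
    ∫ ξ in Set.Ioi (0 : ℝ), Complex.exp ((2 * Real.pi : ℂ) * (x * Complex.I - 1) * ξ) =
      (2 * Real.pi * (1 - x * Complex.I))⁻¹ := by
  rw [integral_exp_mul_complex_Ioi (re_two_pi_mul_sub_one x)]
  simp only [Complex.ofReal_zero, mul_zero, Complex.exp_zero]
  rw [neg_div, ← div_neg, one_div]
  congr 1
  ring

lemma one_sub_mul_I_ne_zero (x : ℝ) : (1 - x * Complex.I : ℂ) ≠ 0 := by
  intro h
  simpa using congrArg Complex.re h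

lemma one_add_mul_I_ne_zero (x : ℝ) : (1 + x * Complex.I : ℂ) ≠ 0 := by
  intro h
  simpa using congrArg Complex.re h

lemma ofReal_one_add_sq (x : ℝ) :
    ((1 + x ^ 2 : ℝ) : ℂ) = (1 - x * Complex.I) * (1 + x * Complex.I) := by
  push_cast
  linear_combination ((x : ℂ) ^ 2) * Complex.I_sq

lemma ofReal_one_add_sq_ne_zero (x : ℝ) : ((1 + x ^ 2 : ℝ) : ℂ) ≠ 0 :=
  Complex.ofReal_ne_zero.2 (by positivity)

lemma fourierInv_expNegAbs (x : ℝ) :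
    𝓕⁻ expNegAbs x = (Real.pi : ℂ)⁻¹ * ((1 + x ^ 2 : ℝ) : ℂ)⁻¹ := by
  rw [fourierInv_real_eq,
    integral_eq_integral_Ioi_add_neg (integrable_exp_mul integrable_expNegAbs x)]
  have h : ∀ t ∈ Set.Ioi (0 : ℝ),
      Complex.exp (2 * Real.pi * x * t * Complex.I) * expNegAbs t +
        Complex.exp (2 * Real.pi * x * (-t : ℝ) * Complex.I) * expNegAbs (-t) =
      Complex.exp ((2 * Real.pi : ℂ) * (x * Complex.I - 1) * t) +
        Complex.exp ((2 * Real.pi : ℂ) * ((-x : ℝ) * Complex.I - 1) * t) := by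
    intro t ht
    simp only [expNegAbs, abs_neg, abs_of_pos (Set.mem_Ioi.1 ht), ← Complex.exp_add]
    congr 2 <;> push_cast <;> ring
  rw [setIntegral_congr_fun measurableSet_Ioi h, integral_add
    (integrableOn_exp_mul_complex_Ioi (re_two_pi_mul_sub_one x) 0)
    (integrableOn_exp_mul_complex_Ioi (re_two_pi_mul_sub_one (-x)) 0),
    integral_Ioi_exp_two_pi, integral_Ioi_exp_two_pi, ofReal_one_add_sq]
  have h1 := one_sub_mul_I_ne_zero x
  have h2 := one_add_mul_I_ne_zero x
  have h3 : (1 - (-x : ℝ) * Complex.I : ℂ) = 1 + x * Complex.I := by push_cast; ring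
  rw [h3, mul_inv, mul_inv, mul_inv, mul_inv, mul_inv]
  have h4 : (1 - x * Complex.I : ℂ)⁻¹ + (1 + x * Complex.I)⁻¹ =
      2 * ((1 - x * Complex.I)⁻¹ * (1 + x * Complex.I)⁻¹) := by
    rw [inv_add_inv h1 h2, div_eq_mul_inv, mul_inv]
    ring
  linear_combination (2⁻¹ * (Real.pi : ℂ)⁻¹) * h4

lemma fourierInv_sgnMul_expNegAbs (x : ℝ) :
    𝓕⁻ (sgnMul expNegAbs) x = (Real.pi : ℂ)⁻¹ * (x * ((1 + x ^ 2 : ℝ) : ℂ)⁻¹) := by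
  rw [fourierInv_real_eq, integral_eq_integral_Ioi_add_neg
    (integrable_exp_mul (integrable_sgnMul integrable_expNegAbs) x)]
  have h : ∀ t ∈ Set.Ioi (0 : ℝ),
      Complex.exp (2 * Real.pi * x * t * Complex.I) * sgnMul expNegAbs t +
        Complex.exp (2 * Real.pi * x * (-t : ℝ) * Complex.I) * sgnMul expNegAbs (-t) =
      -Complex.I * (Complex.exp ((2 * Real.pi : ℂ) * (x * Complex.I - 1) * t) -
        Complex.exp ((2 * Real.pi : ℂ) * ((-x : ℝ) * Complex.I - 1) * t)) := by
    intro t ht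
    have e1 : Complex.exp ((2 * Real.pi : ℂ) * (x * Complex.I - 1) * t) =
        Complex.exp (2 * Real.pi * x * t * Complex.I) * expNegAbs t := by
      simp only [expNegAbs, abs_of_pos (Set.mem_Ioi.1 ht), ← Complex.exp_add]
      congr 1; push_cast; ring
    have e2 : Complex.exp ((2 * Real.pi : ℂ) * ((-x : ℝ) * Complex.I - 1) * t) =
        Complex.exp (2 * Real.pi * x * (-t : ℝ) * Complex.I) * expNegAbs (-t) := by
      simp only [expNegAbs, abs_neg, abs_of_pos (Set.mem_Ioi.1 ht), ← Complex.exp_add]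
      congr 1; push_cast; ring
    rw [e1, e2, sgnMul, sgnMul, Real.sign_neg, Real.sign_of_pos ht]
    push_cast
    ring
  rw [setIntegral_congr_fun measurableSet_Ioi h, integral_const_mul, integral_sub
    (integrableOn_exp_mul_complex_Ioi (re_two_pi_mul_sub_one x) 0)
    (integrableOn_exp_mul_complex_Ioi (re_two_pi_mul_sub_one (-x)) 0),
    integral_Ioi_exp_two_pi, integral_Ioi_exp_two_pi, ofReal_one_add_sq]
  have h1 := one_sub_mul_I_ne_zero x
  have h2 := one_add_mul_I_ne_zero x
  have h3 : (1 - (-x : ℝ) * Complex.I : ℂ) = 1 + x * Complex.I := by push_cast; ring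
  rw [h3, mul_inv, mul_inv, mul_inv, mul_inv, mul_inv]
  have h4 : (1 - x * Complex.I : ℂ)⁻¹ - (1 + x * Complex.I)⁻¹ =
      2 * x * Complex.I * ((1 - x * Complex.I)⁻¹ * (1 + x * Complex.I)⁻¹) := by
    rw [inv_sub_inv h1 h2, div_eq_mul_inv, mul_inv]
    ring
  linear_combination (-Complex.I * 2⁻¹ * (Real.pi : ℂ)⁻¹) * h4 -
    ((Real.pi : ℂ)⁻¹ * x * ((1 - x * Complex.I)⁻¹ * (1 + x * Complex.I)⁻¹)) * Complex.I_sq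

lemma fourierInv_sgnMul_sgnMul (G : ℝ → ℂ) (x : ℝ) :
    𝓕⁻ (sgnMul (sgnMul G)) x = -𝓕⁻ G x := by
  rw [fourierInv_real_eq, fourierInv_real_eq, ← integral_neg]
  have : ∀ᵐ ξ : ℝ, ξ ≠ 0 := by simp [ae_iff]
  refine integral_congr_ae ?_
  filter_upwards [this] with ξ hξ
  have : ((Real.sign ξ : ℝ) : ℂ) * (Real.sign ξ : ℂ) = 1 := by
    rcases Real.sign_apply_eq_of_ne_zero ξ hξ with h | h <;> simp [h]
  simp only [sgnMul]
  linear_combination (Complex.exp (2 * Real.pi * x * ξ * Complex.I) * G ξ *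
    Complex.I ^ 2) * this + (Complex.exp (2 * Real.pi * x * ξ * Complex.I) * G ξ) * Complex.I_sq

lemma continuous_inv_one_add_sq : Continuous fun y : ℝ => ((1 + y ^ 2 : ℝ) : ℂ)⁻¹ :=
  Continuous.inv₀ (by fun_prop) ofReal_one_add_sq_ne_zero

lemma decays_inv_one_add_sq : Decays fun y : ℝ => ((1 + y ^ 2 : ℝ) : ℂ)⁻¹ := by
  refine ⟨continuous_inv_one_add_sq, 2, fun y => ?_⟩
  rw [norm_inv, Complex.norm_real, Real.norm_of_nonneg (by positivity), inv_mul_le_iff₀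
    (by positivity), ← sq_abs]
  nlinarith [sq_nonneg (|y| - 1), sq_nonneg (|y|)]

lemma decays_mul_inv_one_add_sq : Decays fun y : ℝ => (y : ℂ) * ((1 + y ^ 2 : ℝ) : ℂ)⁻¹ := by
  refine ⟨Complex.continuous_ofReal.mul continuous_inv_one_add_sq, 2, fun y => ?_⟩
  rw [norm_mul, norm_inv, Complex.norm_real, Complex.norm_real,
    Real.norm_of_nonneg (by positivity : (0 : ℝ) ≤ 1 + y ^ 2), mul_comm ‖y‖, mul_assoc,
    inv_mul_le_iff₀ (by positivity), ← sq_abs, Real.norm_eq_abs]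
  nlinarith [sq_nonneg (|y| - 1), sq_nonneg (|y|)]

lemma Decays.const_mul {f : ℝ → ℂ} (hf : Decays f) (c : ℂ) : Decays fun y => c * f y := by
  obtain ⟨hc, C, hC⟩ := hf
  refine ⟨hc.const_mul c, ‖c‖ * C, fun y => ?_⟩
  rw [norm_mul, mul_assoc]
  exact mul_le_mul_of_nonneg_left (hC y) (norm_nonneg c)

lemma integral_ofReal_one_add_sq_inv :
    ∫ y : ℝ, ((1 + y ^ 2 : ℝ) : ℂ)⁻¹ = Real.pi := by
  rw [← integral_univ_inv_one_add_sq, ← integral_complex_ofReal]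
  simp

lemma hasPV_mul_inv_one_add_sq_zero :
    HasPV (fun y : ℝ => (y : ℂ) * ((1 + y ^ 2 : ℝ) : ℂ)⁻¹) 0 (-1) := by
  have h0 : HasPV (fun _ => 0) 0 0 := ⟨fun ε _ => by simp, by simp⟩
  have hpi : (Real.pi : ℂ) ≠ 0 := Complex.ofReal_ne_zero.2 Real.pi_ne_zero
  have hint : Integrable fun y : ℝ => ((1 + y ^ 2 : ℝ) : ℂ)⁻¹ := by
    simpa using integrable_inv_one_add_sq.ofReal (𝕜 := ℂ)
  convert! h0.of_eq_add (k := fun y : ℝ => -((1 + y ^ 2 : ℝ) : ℂ)⁻¹) hint.neg fun y => ?_ using 1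
  · rw [integral_neg, integral_ofReal_one_add_sq_inv]
    field_simp
    simp
  · push_cast
    ring

/-- The Dirichlet integral. -/
lemma two_mul_sineIntegralTop_div_pi : (2 * sineIntegralTop / Real.pi : ℝ) = 1 := by
  have hpi : (Real.pi : ℂ) ≠ 0 := Complex.ofReal_ne_zero.2 Real.pi_ne_zero
  have hfun : 𝓕⁻ (sgnMul expNegAbs) =
      fun x : ℝ => (Real.pi : ℂ)⁻¹ * (x * ((1 + x ^ 2 : ℝ) : ℂ)⁻¹) :=
    funext fourierInv_sgnMul_expNegAbs
  have h1 := hasPV_fourierInv_aux (integrable_sgnMul integrable_expNegAbs) (x := 0)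
    fun ε hε => by
      rw [hfun]
      exact (decays_mul_inv_one_add_sq.const_mul _).integrableOn_div 0 hε
  rw [fourierInv_sgnMul_sgnMul, fourierInv_expNegAbs, hfun] at h1
  have h2 := h1.unique (hasPV_mul_inv_one_add_sq_zero.const_mul (Real.pi : ℂ)⁻¹)
  have h3 : ((2 * sineIntegralTop / Real.pi : ℝ) : ℂ) = 1 := by
    simp only [ne_eq, OfNat.ofNat_ne_zero, not_false_eq_true, zero_pow, add_zero,
      Complex.ofReal_one, inv_one, mul_one, mul_neg, neg_inj] at h2
    exact mul_right_cancel₀ (inv_ne_zero hpi) (by rw [h2, one_mul])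
  exact_mod_cast h3

lemma hasPV_fourierInv {G : ℝ → ℂ} (hG : Integrable G) (hd : Decays (𝓕⁻ G)) (x : ℝ) :
    HasPV (𝓕⁻ G) x (𝓕⁻ (sgnMul G) x) := by
  have := hasPV_fourierInv_aux hG fun ε hε => hd.integrableOn_div x hε
  rwa [two_mul_sineIntegralTop_div_pi, Complex.ofReal_one, one_mul] at this

lemma hasPV_inv_one_add_sq (x : ℝ) :
    HasPV (fun y : ℝ => ((1 + y ^ 2 : ℝ) : ℂ)⁻¹) x (x * ((1 + x ^ 2 : ℝ) : ℂ)⁻¹) := by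
  have hpi : (Real.pi : ℂ) ≠ 0 := Complex.ofReal_ne_zero.2 Real.pi_ne_zero
  have hfun : 𝓕⁻ expNegAbs = fun x : ℝ => (Real.pi : ℂ)⁻¹ * ((1 + x ^ 2 : ℝ) : ℂ)⁻¹ :=
    funext fourierInv_expNegAbs
  have h := hasPV_fourierInv integrable_expNegAbs
    (by rw [hfun]; exact decays_inv_one_add_sq.const_mul _) x
  rw [fourierInv_sgnMul_expNegAbs, hfun] at h
  simpa [mul_inv_cancel_left₀ hpi] using h.const_mul (Real.pi : ℂ)

lemma hasPV_mul_inv_one_add_sq (x : ℝ) :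
    HasPV (fun y : ℝ => (y : ℂ) * ((1 + y ^ 2 : ℝ) : ℂ)⁻¹) x (-((1 + x ^ 2 : ℝ) : ℂ)⁻¹) := by
  have hpi : (Real.pi : ℂ) ≠ 0 := Complex.ofReal_ne_zero.2 Real.pi_ne_zero
  have hfun : 𝓕⁻ (sgnMul expNegAbs) =
      fun x : ℝ => (Real.pi : ℂ)⁻¹ * (x * ((1 + x ^ 2 : ℝ) : ℂ)⁻¹) :=
    funext fourierInv_sgnMul_expNegAbs
  have h := hasPV_fourierInv (integrable_sgnMul integrable_expNegAbs)
    (by rw [hfun]; exact decays_mul_inv_one_add_sq.const_mul _) x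
  rw [fourierInv_sgnMul_sgnMul, fourierInv_expNegAbs, hfun] at h
  simpa [mul_inv_cancel_left₀ hpi] using h.const_mul (Real.pi : ℂ)

/-- The Hilbert transform of a Schwartz function, as a Fourier multiplier. -/
noncomputable def hilb (h : SchwartzMap ℝ ℂ) : ℝ → ℂ := 𝓕⁻ (sgnMul (𝓕 (h : ℝ → ℂ)))

namespace SchwartzMap

lemma exists_eq_mul {g : ℝ → ℝ} (hg : g.HasTemperateGrowth) (f : SchwartzMap ℝ ℂ) :
    ∃ k : SchwartzMap ℝ ℂ, ∀ x, k x = g x * f x :=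
  ⟨smulLeftCLM ℂ g f, fun x => by rw [smulLeftCLM_apply_apply hg, Complex.real_smul]⟩

lemma exists_eq_deriv (f : SchwartzMap ℝ ℂ) : ∃ k : SchwartzMap ℝ ℂ, ∀ x, k x = deriv f x :=
  ⟨derivCLM ℝ ℂ f, fun _ => rfl⟩

lemma exists_eq_ofReal_comp (L : ℂ →L[ℝ] ℝ) (f : SchwartzMap ℝ ℂ) :
    ∃ k : SchwartzMap ℝ ℂ, ∀ x, k x = (L (f x) : ℂ) :=
  ⟨f.postcompCLM (Complex.ofRealCLM.comp L), fun _ => rfl⟩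

lemma exists_eq_conj (f : SchwartzMap ℝ ℂ) :
    ∃ k : SchwartzMap ℝ ℂ, ∀ x, k x = starRingEnd ℂ (f x) :=
  ⟨f.postcompCLM (Complex.conjCLE : ℂ →L[ℝ] ℂ), fun _ => rfl⟩

end SchwartzMap

lemma hasTemperateGrowth_one_add_sq_rpow (s : ℝ) :
    (fun x : ℝ => (1 + x ^ 2) ^ s).HasTemperateGrowth := by
  simpa using Function.hasTemperateGrowth_one_add_norm_sq_rpow ℝ s

lemma hasTemperateGrowth_inv_one_add_sq :
    (fun x : ℝ => (1 + x ^ 2)⁻¹).HasTemperateGrowth := by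
  simpa [Real.rpow_neg_one] using hasTemperateGrowth_one_add_sq_rpow (-1)

lemma integrable_fourier_schwartz (h : SchwartzMap ℝ ℂ) : Integrable (𝓕 (h : ℝ → ℂ)) :=
  (𝓕 h).integrable

lemma fourierInv_fourier_schwartz (h : SchwartzMap ℝ ℂ) : 𝓕⁻ (𝓕 (h : ℝ → ℂ)) = h :=
  h.continuous.fourierInv_fourier_eq h.integrable (integrable_fourier_schwartz h)

lemma decays_schwartz (h : SchwartzMap ℝ ℂ) : Decays h := by
  obtain ⟨C, -, hC⟩ := h.decay 0 0
  obtain ⟨D, -, hD⟩ := h.decay 1 0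
  refine ⟨h.continuous, C + D, fun y => ?_⟩
  have h1 := hC y
  have h2 := hD y
  simp only [norm_iteratedFDeriv_zero, pow_zero, one_mul, pow_one, Real.norm_eq_abs] at h1 h2
  linarith

lemma hasPV_schwartz (h : SchwartzMap ℝ ℂ) (x : ℝ) : HasPV h x (hilb h x) := by
  have := hasPV_fourierInv (integrable_fourier_schwartz h)
    (by rw [fourierInv_fourier_schwartz]; exact decays_schwartz h) x
  rwa [fourierInv_fourier_schwartz] at this

lemma hilb_eq_of_hasPV {h : SchwartzMap ℝ ℂ} {f : ℝ → ℂ} (hf : ∀ y, h y = f y) {x : ℝ} {v : ℂ}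
    (hv : HasPV f x v) : hilb h x = v := by
  rw [← funext hf] at hv
  exact (hasPV_schwartz h x).unique hv

lemma hasDerivAt_hilb {h h' : SchwartzMap ℝ ℂ} (hh : ∀ x, h' x = deriv h x) (x : ℝ) :
    HasDerivAt (hilb h) (hilb h' x) x := by
  have hF : 𝓕 (h' : ℝ → ℂ) = fun ξ : ℝ => (2 * Real.pi * Complex.I * ξ) • 𝓕 (h : ℝ → ℂ) ξ := by
    rw [show (h' : ℝ → ℂ) = deriv h from funext hh]
    exact Real.fourier_deriv h.integrable h.differentiable
      (by rw [← show (h' : ℝ → ℂ) = deriv h from funext hh]; exact h'.integrable)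
  have hG := integrable_sgnMul (integrable_fourier_schwartz h)
  have hG' := integrable_sgnMul (integrable_fourier_schwartz h')
  have hmul : ∀ ξ : ℝ, ξ • sgnMul (𝓕 (h : ℝ → ℂ)) ξ =
      (2 * Real.pi * Complex.I : ℂ)⁻¹ * sgnMul (𝓕 (h' : ℝ → ℂ)) ξ := by
    intro ξ
    simp only [sgnMul, hF, Complex.real_smul, smul_eq_mul]
    field_simp
  have hd := Real.hasDerivAt_fourier hG
    (by simpa only [hmul] using hG'.const_mul _) (-x)
  have hd2 := hd.scomp x (hasDerivAt_neg x)
  have e1 : hilb h = (𝓕 (sgnMul (𝓕 (h : ℝ → ℂ)))) ∘ Neg.neg := by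
    ext y
    exact Real.fourierInv_eq_fourier_neg _ y
  rw [e1]
  convert! hd2 using 1
  rw [hilb, Real.fourierInv_eq_fourier_neg, Real.fourier_eq, Real.fourier_eq, neg_smul, one_smul,
    ← integral_neg]
  refine integral_congr_ae (Eventually.of_forall fun ξ => ?_)
  simp only [Circle.smul_def, smul_eq_mul, sgnMul, hF]
  ring

lemma continuous_hilb (h : SchwartzMap ℝ ℂ) : Continuous (hilb h) := by
  obtain ⟨h', hh⟩ := h.exists_eq_deriv
  exact continuous_iff_continuousAt.2 fun x => (hasDerivAt_hilb hh x).continuousAt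

lemma norm_hilb_le (h : SchwartzMap ℝ ℂ) :
    ∃ C, ∀ x, ‖hilb h x‖ ≤ C := by
  refine ⟨∫ ξ, ‖sgnMul (𝓕 (h : ℝ → ℂ)) ξ‖, fun x => ?_⟩
  rw [hilb, fourierInv_real_eq]
  refine (norm_integral_le_integral_norm _).trans (le_of_eq ?_)
  simp only [norm_mul, norm_exp_two_pi, one_mul]

lemma decays_hilb (h : SchwartzMap ℝ ℂ) : Decays (hilb h) := by
  obtain ⟨k, hk⟩ := SchwartzMap.exists_eq_mul Function.HasTemperateGrowth.id' h
  obtain ⟨C, hC⟩ := norm_hilb_le h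
  obtain ⟨D, hD⟩ := norm_hilb_le k
  have key : ∀ y : ℝ, (y : ℂ) * hilb h y = hilb k y + (Real.pi : ℂ)⁻¹ * ∫ z, h z := by
    intro y
    have := ((hasPV_schwartz h y).const_mul (y : ℂ)).of_eq_add h.integrable.neg
      (g := fun z => (z : ℂ) * h z) fun z => by
        simp only [Pi.neg_apply]
        push_cast
        ring
    rw [hilb_eq_of_hasPV hk this]
    simp only [Pi.neg_apply]
    rw [integral_neg]
    ring
  refine ⟨continuous_hilb h, C + (D + ‖(Real.pi : ℂ)⁻¹ * ∫ z, h z‖), fun y => ?_⟩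
  have h1 : ‖hilb h y‖ * |y| ≤ D + ‖(Real.pi : ℂ)⁻¹ * ∫ z, h z‖ := by
    rw [mul_comm, ← Real.norm_eq_abs, ← Complex.norm_real, ← norm_mul, key]
    exact (norm_add_le _ _).trans (add_le_add_left (hD y) _)
  linarith [hC y]

lemma hasPV_hilb (h : SchwartzMap ℝ ℂ) (x : ℝ) : HasPV (hilb h) x (-h x) := by
  have := hasPV_fourierInv (integrable_sgnMul (integrable_fourier_schwartz h)) (decays_hilb h) x
  rwa [fourierInv_sgnMul_sgnMul, fourierInv_fourier_schwartz] at this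

/-- The Tricomi-type identity behind the factorization `-𝐃̃_Q 𝐃̃_Q = H_Q`. -/
lemma hasPV_mul_inv_mul_add_inv_mul_hilb (h : SchwartzMap ℝ ℂ) (x : ℝ) :
    HasPV (fun y : ℝ => (y : ℂ) * (((1 + y ^ 2 : ℝ) : ℂ)⁻¹ * h y) +
      ((1 + y ^ 2 : ℝ) : ℂ)⁻¹ * hilb h y) x
      (((1 + x ^ 2 : ℝ) : ℂ)⁻¹ * (x * hilb h x - h x)) := by
  obtain ⟨u, hu⟩ := SchwartzMap.exists_eq_mul hasTemperateGrowth_inv_one_add_sq h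
  have hu' : ∀ y, u y = ((1 + y ^ 2 : ℝ) : ℂ)⁻¹ * h y := fun y => by
    rw [hu, Complex.ofReal_inv]
  have hilb_u := fun y => hilb_eq_of_hasPV hu' ((hasPV_schwartz h y).inv_mul (decays_schwartz h))
  have hA := (hasPV_hilb h x).inv_mul (decays_hilb h)
  have hB := (hasPV_schwartz h x).mul_inv_mul (decays_schwartz h)
  set a := ∫ y : ℝ, ((1 + y ^ 2 : ℝ) : ℂ)⁻¹ * h y
  set b := ∫ y : ℝ, (y : ℂ) * (((1 + y ^ 2 : ℝ) : ℂ)⁻¹ * h y)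
  set a' := ∫ y : ℝ, ((1 + y ^ 2 : ℝ) : ℂ)⁻¹ * hilb h y
  set b' := ∫ y : ℝ, (y : ℂ) * (((1 + y ^ 2 : ℝ) : ℂ)⁻¹ * hilb h y)
  have hC := hA.add (((hasPV_mul_inv_one_add_sq x).const_mul ((Real.pi : ℂ)⁻¹ * a)).add
    ((hasPV_inv_one_add_sq x).const_mul ((Real.pi : ℂ)⁻¹ * b)))
  have hE := (hasPV_hilb u x).unique (by
    convert! hC using 1
    ext y
    rw [hilb_u]
    ring)
  rw [hu'] at hE
  convert! hB.add hA using 1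
  linear_combination hE

lemma integral_hilb_mul (u v : SchwartzMap ℝ ℂ) :
    ∫ x, hilb u x * v x = -∫ x, u x * hilb v x := by
  rw [hilb, integral_fourierInv_mul_eq (integrable_sgnMul (integrable_fourier_schwartz u))
    v.integrable]
  simp only [mul_comm (u _)]
  rw [hilb, integral_fourierInv_mul_eq (integrable_sgnMul (integrable_fourier_schwartz v))
    u.integrable, ← integral_neg_eq_self, ← integral_neg]
  refine integral_congr_ae (Eventually.of_forall fun ξ => ?_)
  simp only [sgnMul, Real.fourierInv_eq_fourier_neg, Real.sign_neg, neg_neg]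
  push_cast
  ring

lemma pvH_eq_hilb {h : SchwartzMap ℝ ℂ} {f : ℝ → ℂ} (hf : ∀ y, h y = f y) (x : ℝ) :
    pvH f x = hilb h x := by
  rw [← funext hf]
  exact (hasPV_schwartz h x).pvH_eq

lemma Qr_eq_rpow (x : ℝ) : Qr x = Real.sqrt 2 * (1 + x ^ 2) ^ (-(1 / 2) : ℝ) := by
  rw [Qr, Real.rpow_neg (by positivity), ← Real.sqrt_eq_rpow, div_eq_mul_inv]

lemma hasTemperateGrowth_Qr : Qr.HasTemperateGrowth := by
  rw [funext Qr_eq_rpow]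
  exact (Function.HasTemperateGrowth.const _).mul (hasTemperateGrowth_one_add_sq_rpow _)

lemma Qc_sq (x : ℝ) : Qc x ^ 2 = 2 * ((1 + x ^ 2 : ℝ) : ℂ)⁻¹ := by
  rw [Qc, ← Complex.ofReal_pow, Qr, div_pow, Real.sq_sqrt zero_le_two,
    Real.sq_sqrt (by positivity)]
  push_cast
  rw [div_eq_mul_inv]

lemma hasDerivAt_Qc (x : ℝ) :
    HasDerivAt Qc (-(x * ((1 + x ^ 2 : ℝ) : ℂ)⁻¹ * Qc x)) x := by
  have h0 : (1 + x ^ 2 : ℝ) ≠ 0 := by positivity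
  have h1 : HasDerivAt (fun y : ℝ => 1 + y ^ 2) (2 * x) x := by
    simpa using (hasDerivAt_pow 2 x).const_add 1
  have h2 := (h1.rpow_const (p := -(1 / 2)) (Or.inl h0)).const_mul (Real.sqrt 2)
  rw [← funext Qr_eq_rpow] at h2
  convert! h2.ofReal_comp using 1
  rw [Real.rpow_sub_one h0, Qc, Qr_eq_rpow]
  push_cast
  ring

lemma pvH_Qc_sq (x : ℝ) :
    pvH (fun y => Qc y ^ 2) x = 2 * (x * ((1 + x ^ 2 : ℝ) : ℂ)⁻¹) := by
  simp only [Qc_sq]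
  exact ((hasPV_inv_one_add_sq x).const_mul 2).pvH_eq

lemma hasDerivAt_mul_inv_one_add_sq (x : ℝ) :
    HasDerivAt (fun y : ℝ => (y : ℂ) * ((1 + y ^ 2 : ℝ) : ℂ)⁻¹)
      (((1 + x ^ 2 : ℝ) : ℂ)⁻¹ - 2 * (x * ((1 + x ^ 2 : ℝ) : ℂ)⁻¹) ^ 2) x := by
  have h0 : (1 + x ^ 2 : ℝ) ≠ 0 := by positivity
  have h1 : HasDerivAt (fun y : ℝ => 1 + y ^ 2) (2 * x) x := by
    simpa using (hasDerivAt_pow 2 x).const_add 1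
  have h2 := ((hasDerivAt_id x).mul (h1.inv h0)).ofReal_comp
  convert! h2 using 1
  · ext y
    simp
  · have := ofReal_one_add_sq_ne_zero x
    simp only [id, Pi.inv_apply]
    push_cast at this ⊢
    field_simp
    ring

section

variable {f h h' : SchwartzMap ℝ ℂ}

lemma deriv_soliton_mul (hh : ∀ x, h x = Qr x * f x) (x : ℝ) :
    deriv h x = Qc x * deriv f x - x * ((1 + x ^ 2 : ℝ) : ℂ)⁻¹ * h x := by
  rw [show (h : ℝ → ℂ) = fun y => Qc y * f y from funext hh,
    ((hasDerivAt_Qc x).fun_mul (f.hasDerivAt x)).deriv]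
  ring

lemma HQ_eq (hh : ∀ x, h x = Qr x * f x) (hh' : ∀ x, h' x = deriv h x) (x : ℝ) :
    HQ f x = -deriv (deriv f) x + ((1 + x ^ 2 : ℝ) : ℂ)⁻¹ ^ 2 * f x - Qc x * hilb h' x := by
  rw [HQ, pvH_eq_hilb (h := h') (fun y => by
    rw [hh', show (h : ℝ → ℂ) = fun y => Qc y * f y from funext hh])]
  linear_combination (1 / 4 * f x * (Qc x ^ 2 + 2 * ((1 + x ^ 2 : ℝ) : ℂ)⁻¹)) * Qc_sq x

lemma DtQ_eq (hh : ∀ x, h x = Qr x * f x) (x : ℝ) :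
    DtQ f x = deriv f x + 1 / 2 * Qc x * hilb h x := by
  rw [DtQ, pvH_eq_hilb (f := fun y => Qc y * f y) hh]

end

lemma hilb_im_eq_zero {a : SchwartzMap ℝ ℂ} {b : ℝ → ℝ} (hb : ∀ y, a y = b y) (x : ℝ) :
    (hilb a x).im = 0 := by
  have := hasPV_schwartz a x
  rw [funext hb] at this
  exact this.im_eq_zero

lemma hasDerivAt_deriv_schwartz (f : SchwartzMap ℝ ℂ) (x : ℝ) :
    HasDerivAt (deriv f) (deriv (deriv f) x) x := by
  obtain ⟨f', hf⟩ := f.exists_eq_deriv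
  rw [← funext hf]
  exact f'.hasDerivAt x

theorem LQ_I_mul_LQs (f : SchwartzMap ℝ ℂ) (x : ℝ) :
    LQ (fun y => Complex.I * LQs f y) x = Complex.I * HQ f x := by
  obtain ⟨h, hh⟩ := SchwartzMap.exists_eq_mul hasTemperateGrowth_Qr f
  obtain ⟨h', hh'⟩ := h.exists_eq_deriv
  obtain ⟨a, ha⟩ := h.exists_eq_ofReal_comp Complex.reCLM
  obtain ⟨a', ha'⟩ := h'.exists_eq_ofReal_comp Complex.reCLM
  obtain ⟨b', hb'⟩ := h'.exists_eq_ofReal_comp Complex.imCLM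
  simp only [Complex.reCLM_apply, Complex.imCLM_apply] at ha ha' hb'
  have haa' : ∀ y, a' y = deriv a y := fun y => by
    have := (Complex.reCLM.hasFDerivAt.comp_hasDerivAt y (h.hasDerivAt y)).ofReal_comp
    rw [funext ha, ha', hh']
    exact this.deriv.symm
  have hsum : hilb h' x = hilb a' x + Complex.I * hilb b' x :=
    hilb_eq_of_hasPV (fun y => by rw [ha', hb', mul_comm Complex.I, Complex.re_add_im])
      ((hasPV_schwartz a' x).add ((hasPV_schwartz b' x).const_mul Complex.I))
  have hLQs : ∀ y, LQs f y = -deriv f y + y * ((1 + y ^ 2 : ℝ) : ℂ)⁻¹ * f y - Qc y * hilb a y := by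
    intro y
    rw [LQs, pvH_Qc_sq, pvH_eq_hilb (h := a) (fun z => by rw [ha, hh, Qc])]
    ring
  have hd := (((hasDerivAt_deriv_schwartz f x).fun_neg.fun_add
    ((hasDerivAt_mul_inv_one_add_sq x).fun_mul (f.hasDerivAt x))).fun_sub
    ((hasDerivAt_Qc x).fun_mul (hasDerivAt_hilb haa' x))).const_mul Complex.I
  simp only [← hLQs] at hd
  have hre : ∀ y, b' y = (((Qc y * (Complex.I * LQs f y)).re : ℝ) : ℂ) := by
    intro y
    rw [hb', hh', deriv_soliton_mul hh, hLQs, hh]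
    have him := hilb_im_eq_zero ha y
    have e : Qc y * (Complex.I * (-deriv f y + y * ((1 + y ^ 2 : ℝ) : ℂ)⁻¹ * f y -
        Qc y * hilb a y)) = Complex.I * (((Qr y : ℝ) : ℂ) * -deriv f y +
        ((Qr y * (y * (1 + y ^ 2)⁻¹) : ℝ) : ℂ) * f y - ((Qr y ^ 2 : ℝ) : ℂ) * hilb a y) := by
      rw [Qc]; push_cast; ring
    have e' : Qc y * deriv f y - y * ((1 + y ^ 2 : ℝ) : ℂ)⁻¹ * (Qr y * f y) =
        ((Qr y : ℝ) : ℂ) * deriv f y - ((Qr y * (y * (1 + y ^ 2)⁻¹) : ℝ) : ℂ) * f y := by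
      rw [Qc]; push_cast; ring
    rw [e, e', Complex.I_mul_re]
    simp only [Complex.sub_im, Complex.add_im, Complex.im_ofReal_mul, Complex.neg_im, him]
    push_cast
    ring
  rw [LQ, hd.deriv, pvH_Qc_sq, pvH_eq_hilb hre, HQ_eq hh hh', hsum, hLQs]
  have hr : ((1 + x ^ 2 : ℝ) : ℂ)⁻¹ = ((1 + x ^ 2 : ℝ) : ℂ)⁻¹ ^ 2 * (1 + x ^ 2) := by
    have := ofReal_one_add_sq_ne_zero x
    push_cast at this ⊢
    field_simp
  linear_combination (Complex.I * f x) * hr + (Qc x * hilb b' x) * Complex.I_sq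

theorem neg_DtQ_DtQ (f : SchwartzMap ℝ ℂ) (x : ℝ) : -DtQ (DtQ f) x = HQ f x := by
  obtain ⟨h, hh⟩ := SchwartzMap.exists_eq_mul hasTemperateGrowth_Qr f
  obtain ⟨h', hh'⟩ := h.exists_eq_deriv
  have hd := (hasDerivAt_deriv_schwartz f x).fun_add
    (((hasDerivAt_Qc x).const_mul (1 / 2)).fun_mul (hasDerivAt_hilb hh' x))
  have hpv := (hasPV_schwartz h' x).add (hasPV_mul_inv_mul_add_inv_mul_hilb h x)
  have hQD : (fun y => Qc y * DtQ f y) = fun y : ℝ => h' y +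
      (y * (((1 + y ^ 2 : ℝ) : ℂ)⁻¹ * h y) + ((1 + y ^ 2 : ℝ) : ℂ)⁻¹ * hilb h y) := by
    ext y
    rw [DtQ_eq hh, hh', deriv_soliton_mul hh]
    linear_combination (1 / 2 * hilb h y) * Qc_sq y
  rw [← funext (DtQ_eq hh)] at hd
  rw [← hQD] at hpv
  rw [DtQ, hd.deriv, hpv.pvH_eq, HQ_eq hh hh', show h x = Qc x * f x from hh x]
  linear_combination (1 / 2 * ((1 + x ^ 2 : ℝ) : ℂ)⁻¹ * f x) * Qc_sq x

lemma Decays.integrable_mul_schwartz {u : ℝ → ℂ} (hu : Decays u) (v : SchwartzMap ℝ ℂ) :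
    Integrable fun x => u x * v x := by
  obtain ⟨hc, C, hC⟩ := hu
  refine v.integrable.bdd_mul (c := C) hc.aestronglyMeasurable (Eventually.of_forall fun x => ?_)
  refine le_trans ?_ (hC x)
  nlinarith [norm_nonneg (u x), abs_nonneg x]

theorem integral_re_DtQ_mul (f g : SchwartzMap ℝ ℂ) :
    ∫ x, (DtQ f x * starRingEnd ℂ (g x)).re = ∫ x, (f x * starRingEnd ℂ (-DtQ g x)).re := by
  obtain ⟨h, hh⟩ := SchwartzMap.exists_eq_mul hasTemperateGrowth_Qr f
  obtain ⟨k, hk⟩ := SchwartzMap.exists_eq_mul hasTemperateGrowth_Qr g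
  obtain ⟨f', hf'⟩ := f.exists_eq_deriv
  obtain ⟨gc, hgc⟩ := g.exists_eq_conj
  obtain ⟨gc', hgc'⟩ := gc.exists_eq_deriv
  obtain ⟨kc, hkc⟩ := k.exists_eq_conj
  have hkc' : ∀ x, kc x = Qc x * gc x := fun x => by
    rw [hkc, hk, hgc, map_mul, Complex.conj_ofReal, Qc]
  have hilb_kc : ∀ x, hilb kc x = starRingEnd ℂ (hilb k x) := fun x =>
    hilb_eq_of_hasPV hkc (hasPV_schwartz k x).conj
  have hderiv : ∀ x, gc' x = starRingEnd ℂ (deriv g x) := fun x => by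
    rw [hgc', funext hgc]
    exact (Complex.conjCLE.toContinuousLinearMap.hasFDerivAt.comp_hasDerivAt x
      (g.hasDerivAt x)).deriv
  have e1 : ∀ x, DtQ f x * starRingEnd ℂ (g x) =
      f' x * gc x + 1 / 2 * (hilb h x * kc x) := fun x => by
    rw [DtQ_eq hh, hf', hkc', hgc]
    ring
  have e2 : ∀ x, f x * starRingEnd ℂ (-DtQ g x) =
      -(f x * gc' x + 1 / 2 * (h x * hilb kc x)) := fun x => by
    rw [DtQ_eq hk, hderiv, hilb_kc, hh, map_neg, map_add, map_mul, map_mul, Qc,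
      Complex.conj_ofReal]
    simp only [map_div₀, map_one, map_ofNat]
    ring
  have i1 := (decays_schwartz f').integrable_mul_schwartz gc
  have i2 := ((decays_hilb h).integrable_mul_schwartz kc).const_mul (1 / 2)
  have i3 := (decays_schwartz f).integrable_mul_schwartz gc'
  have i4 := ((decays_hilb kc).integrable_mul_schwartz h).const_mul (1 / 2)
  simp only [mul_comm (hilb kc _)] at i4
  have key : ∫ x, (f' x * gc x + 1 / 2 * (hilb h x * kc x)) =
      ∫ x, -(f x * gc' x + 1 / 2 * (h x * hilb kc x)) := by
    rw [integral_neg, integral_add i1 i2, integral_add i3 i4, integral_const_mul,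
      integral_const_mul, integral_hilb_mul]
    simp only [hf', hgc']
    rw [SchwartzMap.integral_mul_deriv_eq_neg_deriv_mul]
    ring
  simp only [e1, e2]
  exact (integral_re (i1.add i2)).trans ((congrArg Complex.re key).trans
    (integral_re (i3.add i4).neg).symm)

/-- Linear conjugation identity: `L_Q i L_Q* = i H_Q = i 𝐃̃_Q* 𝐃̃_Q`, with
`𝐃̃_Q* = −𝐃̃_Q` the formal adjoint with respect to `(·,·)_r`. -/
theorem stmt11 :
    (∀ f : SchwartzMap ℝ ℂ, ∀ x : ℝ,
        LQ (fun y => Complex.I * LQs (fun z => f z) y) x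
          = Complex.I * HQ (fun y => f y) x) ∧
    (∀ f : SchwartzMap ℝ ℂ, ∀ x : ℝ,
        -DtQ (DtQ (fun y => f y)) x = HQ (fun y => f y) x) ∧
    (∀ f g : SchwartzMap ℝ ℂ,
        (∫ x : ℝ, (DtQ (fun y => f y) x * (starRingEnd ℂ) (g x)).re)
          = ∫ x : ℝ, (f x * (starRingEnd ℂ) (-DtQ (fun y => g y) x)).re) :=
  ⟨LQ_I_mul_LQs, neg_DtQ_DtQ, integral_re_DtQ_mul⟩
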